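/- Let D be an integral domain that is not a field, let Q be its quotient field, and let Q/D be the quotient D-module. Then fPD(D(+)(Q/D)) = fPD(D) − 1; equivalently, fPD(D) = fPD(D(+)(Q/D)) + 1 in ℕ ∪ {∞}. -/

import Mathlib

open CategoryTheory

universe u

/-- `M` has a projective resolution `0 → P_n → ⋯ → P_0 → M → 0` of length at most `n`
(the `P_i` projective, not necessarily finitely generated). -/
def HasProjResLE (R : Type u) [CommRing R] :
    ℕ → ∀ (M : Type u) [AddCommGroup M] [Module R M], Prop
  | 0, M, _, _ => Module.Projective R M
  | n + 1, M, _, _ => ∃ (P : Type u) (_ : AddCommGroup P) (_ : Module R P) (f : P →ₗ[R] M),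
      Module.Projective R P ∧ Function.Surjective f ∧ HasProjResLE R n (LinearMap.ker f)

/-- `M` has a finite projective resolution `0 → P_n → ⋯ → P_0 → M → 0` of length `n`
with each `P_i` finitely generated projective. -/
def HasFPRLen (R : Type u) [CommRing R] :
    ℕ → ∀ (M : Type u) [AddCommGroup M] [Module R M], Prop
  | 0, M, _, _ => Module.Finite R M ∧ Module.Projective R M
  | n + 1, M, _, _ => ∃ (P : Type u) (_ : AddCommGroup P) (_ : Module R P) (f : P →ₗ[R] M),
      Module.Finite R P ∧ Module.Projective R P ∧ Function.Surjective f ∧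
        HasFPRLen R n (LinearMap.ker f)

/-- `M` has a finite projective resolution by finitely generated projectives. -/
def HasFPR (R : Type u) [CommRing R] (M : Type u) [AddCommGroup M] [Module R M] : Prop :=
  ∃ n, HasFPRLen R n M

/-- The projective dimension of `M`, as an element of `ℕ∞` (with `⊤` meaning no finite
projective resolution exists). -/
noncomputable def projDim (R : Type u) [CommRing R] (M : Type u) [AddCommGroup M]
    [Module R M] : ℕ∞ :=
  sInf {n : ℕ∞ | ∃ m : ℕ, n = m ∧ HasProjResLE R m M}

/-- The small finitistic dimension `fPD R`: the supremum, in `ℕ∞`, of the projective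
dimensions of `R`-modules having a finite projective resolution. -/
noncomputable def fPD (R : Type u) [CommRing R] : ℕ∞ :=
  ⨆ (M : ModuleCat.{u} R) (_ : HasFPR R M), projDim R M

/-- For a module over a commutative ring, the canonical right module structure. -/
noncomputable local instance moduleOpOfModule (R : Type u) [CommRing R] (M : Type u)
    [AddCommGroup M] [Module R M] : Module Rᵐᵒᵖ M :=
  Module.compHom M ((RingHom.id R).fromOpposite mul_comm)

local instance isCentralScalarOfModule (R : Type u) [CommRing R] (M : Type u)
    [AddCommGroup M] [Module R M] : IsCentralScalar R M :=
  ⟨fun _ _ => rfl⟩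


section ProjectiveResolutions

variable {R : Type u} [CommRing R] {M N : Type u} [AddCommGroup M] [Module R M]
  [AddCommGroup N] [Module R N]

/-- The kernel of a surjection from a projective module drops the projective dimension by one. -/
theorem hasProjectiveDimensionLE_succ_iff_ker {f : N →ₗ[R] M} (hN : Module.Projective R N)
    (hf : Function.Surjective f) (n : ℕ) :
    HasProjectiveDimensionLE (ModuleCat.of R M) (n + 1) ↔
      HasProjectiveDimensionLE (ModuleCat.of R (LinearMap.ker f)) n := by
  have hex : Function.Exact (LinearMap.ker f).subtype f := LinearMap.exact_subtype_ker_map f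
  have hS := ModuleCat.shortComplex_shortExact
    (ModuleCat.shortComplexOfCompEqZero (LinearMap.ker f).subtype f hex.linearMap_comp_eq_zero)
    hex (Submodule.injective_subtype _) hf
  exact hS.hasProjectiveDimensionLT_X₃_iff n ((IsProjective.iff_projective (R := R) N).1 hN)

theorem hasProjResLE_iff_hasProjectiveDimensionLE {n : ℕ} :
    HasProjResLE R n M ↔ HasProjectiveDimensionLE (ModuleCat.of R M) n := by
  induction n generalizing M with
  | zero =>
    rw [← projective_iff_hasProjectiveDimensionLE_zero]
    exact IsProjective.iff_projective (R := R) M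
  | succ n ih =>
    constructor
    · rintro ⟨P, _, _, f, hP, hf, h⟩
      exact (hasProjectiveDimensionLE_succ_iff_ker hP hf n).2 (ih.1 h)
    · intro h
      refine ⟨M →₀ R, inferInstance, inferInstance, Finsupp.linearCombination R id,
        inferInstance, Finsupp.linearCombination_id_surjective R M, ih.2 ?_⟩
      exact (hasProjectiveDimensionLE_succ_iff_ker inferInstance
        (Finsupp.linearCombination_id_surjective R M) n).1 h

theorem HasProjResLE.mono {m n : ℕ} (h : HasProjResLE R m M) (hmn : m ≤ n) :
    HasProjResLE R n M := by
  rw [hasProjResLE_iff_hasProjectiveDimensionLE] at h ⊢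
  exact hasProjectiveDimensionLT_of_ge _ (m + 1) (n + 1) (by lia)

theorem HasProjResLE.of_equiv {n : ℕ} (h : HasProjResLE R n M) (e : M ≃ₗ[R] N) :
    HasProjResLE R n N := by
  rw [hasProjResLE_iff_hasProjectiveDimensionLE] at h ⊢
  exact hasProjectiveDimensionLT_of_iso e.toModuleIso (n + 1)

theorem HasProjResLE.ker {n : ℕ} (h : HasProjResLE R (n + 1) M) {f : N →ₗ[R] M}
    (hN : Module.Projective R N) (hf : Function.Surjective f) :
    HasProjResLE R n (LinearMap.ker f) := by
  rw [hasProjResLE_iff_hasProjectiveDimensionLE] at h ⊢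
  exact (hasProjectiveDimensionLE_succ_iff_ker hN hf n).1 h

theorem HasFPRLen.of_equiv {n : ℕ} (h : HasFPRLen R n M) (e : M ≃ₗ[R] N) :
    HasFPRLen R n N := by
  cases n with
  | zero =>
    obtain ⟨_, _⟩ := h
    exact ⟨Module.Finite.equiv e, Module.Projective.of_equiv e⟩
  | succ n =>
    obtain ⟨P, _, _, f, hfin, hproj, hf, h⟩ := h
    refine ⟨P, _, _, e.toLinearMap ∘ₗ f, hfin, hproj, e.surjective.comp hf, ?_⟩
    rwa [LinearEquiv.ker_comp]

theorem HasFPRLen.finite {n : ℕ} (h : HasFPRLen R n M) : Module.Finite R M := by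
  cases n with
  | zero => exact h.1
  | succ n =>
    obtain ⟨P, _, _, f, hfin, -, hf, -⟩ := h
    exact Module.Finite.of_surjective f hf

theorem projDim_le_iff {n : ℕ} : projDim R M ≤ n ↔ HasProjResLE R n M := by
  constructor
  · intro h
    have hne : {k : ℕ∞ | ∃ m : ℕ, k = m ∧ HasProjResLE R m M}.Nonempty := by
      by_contra hne
      rw [Set.not_nonempty_iff_eq_empty] at hne
      rw [projDim, hne, sInf_empty] at h
      exact (ENat.natCast_lt_top n).not_ge h
    obtain ⟨m, hm, hres⟩ := csInf_mem hne
    rw [projDim, hm] at h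
    exact hres.mono (by exact_mod_cast h)
  · intro h
    exact sInf_le ⟨n, rfl, h⟩

theorem fPD_le_iff {n : ℕ} :
    fPD R ≤ n ↔ ∀ (M : Type u) [AddCommGroup M] [Module R M], HasFPR R M → HasProjResLE R n M := by
  simp only [fPD, iSup_le_iff, projDim_le_iff]
  exact ⟨fun h M _ _ => h (ModuleCat.of R M), fun h M => h M⟩

end ProjectiveResolutions

section BaseChange

open TensorProduct

variable {A : Type u} [CommRing A] (B : Type u) [CommRing B] [Algebra A B]
  {M P : Type u} [AddCommGroup M] [Module A M] [AddCommGroup P] [Module A P]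

/-- If base change to `B` preserves the injectivity of `ker f → P`, then it commutes with
the kernel of the surjection `f`. -/
noncomputable def baseChangeKerEquiv (f : P →ₗ[A] M) (hf : Function.Surjective f)
    (hinj : Function.Injective ((LinearMap.ker f).subtype.baseChange B)) :
    B ⊗[A] LinearMap.ker f ≃ₗ[B] LinearMap.ker (f.baseChange B) :=
  LinearEquiv.ofInjective _ hinj ≪≫ₗ LinearEquiv.ofEq _ _
    (SetLike.ext fun x => (lTensor_exact B (LinearMap.exact_subtype_ker_map f) hf x).symm)

end BaseChange

/-- A finitely generated torsion-free module over a domain embeds in a finite free module. -/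
theorem exists_injective_of_finite_of_isTorsionFree (D : Type u) [CommRing D] [IsDomain D]
    (N : Type u) [AddCommGroup N] [Module D N] [Module.Finite D N] [Module.IsTorsionFree D N] :
    ∃ (F : Type u) (_ : AddCommGroup F) (_ : Module D F) (i : N →ₗ[D] F),
      Module.Finite D F ∧ Module.Projective D F ∧ Function.Injective i := by
  obtain ⟨n, s, hs⟩ := Module.Finite.exists_fin (R := D) (M := N)
  obtain ⟨I, hI, hmax⟩ := exists_maximal_linearIndepOn D s
  let F := Submodule.span D (Set.range fun i : I => s i)
  let b : Module.Basis I D F := Module.Basis.span hI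
  have exists_mul_mem (i : Fin n) : ∃ a : D, a ≠ 0 ∧ a • s i ∈ F := by
    by_cases hi : i ∈ I
    · exact ⟨1, one_ne_zero, by
        rw [one_smul]
        exact Submodule.subset_span ⟨⟨i, hi⟩, rfl⟩⟩
    · simpa [F, Set.image_eq_range s I] using hmax i hi
  choose a ha hmem using exists_mul_mem
  have hA : ∏ i, a i ≠ 0 := Finset.prod_ne_zero_iff.2 fun i _ => ha i
  have hle (x : N) : LinearMap.lsmul D N (∏ i, a i) x ∈ F := by
    have hx : x ∈ Submodule.span D (Set.range s) := hs ▸ Submodule.mem_top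
    induction hx using Submodule.span_induction with
    | mem x hx =>
      obtain ⟨i, rfl⟩ := hx
      rw [LinearMap.lsmul_apply, Fintype.prod_eq_prod_compl_mul i, mul_smul]
      exact F.smul_mem _ (hmem i)
    | zero => simp
    | add x y _ _ hx hy => rw [map_add]; exact F.add_mem hx hy
    | smul c x _ hx => rw [map_smul]; exact F.smul_mem _ hx
  refine ⟨F, inferInstance, inferInstance, LinearMap.codRestrict F (LinearMap.lsmul D N _) hle,
    Module.Finite.of_basis b, Module.Projective.of_basis b, ?_⟩
  rw [← LinearMap.ker_eq_bot, LinearMap.ker_codRestrict, LinearMap.ker_lsmul hA]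


section FractionQuotientExtension

open TensorProduct

variable {D R : Type u} [CommRing D] [CommRing R] [Algebra D R] [Algebra R D]

/-- The elements `ε s` behave like the elements `(0, 1/s)` of the trivial extension
`R = D(+)(Q/D)` of a domain `D`. -/
structure IsFractionQuotientExt (ε : D → R) : Prop where
  mul_eps : ∀ s t : D, s ≠ 0 → t ≠ 0 → algebraMap D R s * ε (s * t) = ε t
  eps_one : ε 1 = 0
  eps_mul_eps : ∀ s t : D, ε s * ε t = 0
  algebraMap_eps : ∀ s : D, algebraMap R D (ε s) = 0
  exists_eq : ∀ r : R, ∃ a s : D, s ≠ 0 ∧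
    r = algebraMap D R (algebraMap R D r) + algebraMap D R a * ε s
  dvd_of_mul_eps : ∀ a s : D, s ≠ 0 → algebraMap D R a * ε s = 0 → s ∣ a

theorem smul_one_tmul {M : Type u} [AddCommGroup M] [Module R M] [IsScalarTower D R D] (d : D)
    (m : M) :
    d • ((1 : D) ⊗ₜ[R] m) = (1 : D) ⊗ₜ[R] (algebraMap D R d • m) := by
  rw [← TensorProduct.smul_tmul, TensorProduct.smul_tmul', Algebra.smul_def (algebraMap D R d),
    ← IsScalarTower.algebraMap_apply]
  simp

theorem exists_one_tmul {M : Type u} [AddCommGroup M] [Module R M] [IsScalarTower D R D]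
    (x : D ⊗[R] M) : ∃ m : M, x = 1 ⊗ₜ[R] m := by
  induction x using TensorProduct.induction_on with
  | zero => exact ⟨0, by simp⟩
  | tmul d m =>
    exact ⟨algebraMap D R d • m, by rw [← smul_one_tmul, smul_tmul', smul_eq_mul, mul_one]⟩
  | add x y hx hy =>
    obtain ⟨m, rfl⟩ := hx
    obtain ⟨m', rfl⟩ := hy
    exact ⟨m + m', by rw [tmul_add]⟩

namespace IsFractionQuotientExt

variable {ε : D → R}

theorem mul_eps_self (hε : IsFractionQuotientExt ε) {s : D} (hs : s ≠ 0) :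
    algebraMap D R s * ε s = 0 := by
  nontriviality D
  simpa [hε.eps_one] using hε.mul_eps s 1 hs one_ne_zero

end IsFractionQuotientExt

variable [IsDomain D]

/-- The submodule `J M`, where `J` is the kernel of `R → D`. -/
def epsSubmodule {ε : D → R} (hε : IsFractionQuotientExt ε) (M : Type u) [AddCommGroup M]
    [Module R M] : Submodule R M where
  carrier := {m | ∃ s : D, s ≠ 0 ∧ ∃ x : M, m = ε s • x}
  zero_mem' := ⟨1, one_ne_zero, 0, by simp⟩
  add_mem' := by
    rintro _ _ ⟨s, hs, x, rfl⟩ ⟨t, ht, y, rfl⟩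
    refine ⟨s * t, mul_ne_zero hs ht, algebraMap D R t • x + algebraMap D R s • y, ?_⟩
    rw [smul_add, smul_smul, smul_smul, mul_comm (ε (s * t)) (algebraMap D R s),
      hε.mul_eps s t hs ht, mul_comm s t, mul_comm (ε (t * s)) (algebraMap D R t),
      hε.mul_eps t s ht hs]
  smul_mem' := by
    rintro r _ ⟨s, hs, x, rfl⟩
    exact ⟨s, hs, r • x, smul_comm _ _ _⟩

namespace IsFractionQuotientExt

variable {ε : D → R} (hε : IsFractionQuotientExt ε)
  {M P : Type u} [AddCommGroup M] [Module R M] [AddCommGroup P] [Module R P]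

theorem eps_smul_mem {s : D} (hs : s ≠ 0) (x : M) : ε s • x ∈ epsSubmodule hε M :=
  ⟨s, hs, x, rfl⟩

theorem map_mem (f : M →ₗ[R] P) {m : M} (hm : m ∈ epsSubmodule hε M) :
    f m ∈ epsSubmodule hε P := by
  obtain ⟨s, hs, x, rfl⟩ := hm
  exact ⟨s, hs, f x, map_smul _ _ _⟩

theorem eps_smul_eq_zero (s : D) {m : M} (hm : m ∈ epsSubmodule hε M) : ε s • m = 0 := by
  obtain ⟨t, _, x, rfl⟩ := hm
  rw [smul_smul, hε.eps_mul_eps, zero_smul]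

theorem exists_smul_eq_zero {m : M} (hm : m ∈ epsSubmodule hε M) :
    ∃ s : D, s ≠ 0 ∧ algebraMap D R s • m = 0 := by
  obtain ⟨s, hs, x, rfl⟩ := hm
  exact ⟨s, hs, by rw [smul_smul, hε.mul_eps_self hs, zero_smul]⟩

theorem exists_eq_smul {m : M} (hm : m ∈ epsSubmodule hε M) {s : D} (hs : s ≠ 0) :
    ∃ x ∈ epsSubmodule hε M, m = algebraMap D R s • x := by
  obtain ⟨t, ht, x, rfl⟩ := hm
  exact ⟨_, hε.eps_smul_mem (mul_ne_zero hs ht) x, by rw [smul_smul, hε.mul_eps s t hs ht]⟩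

theorem sub_smul_mem (r : R) (m : M) :
    r • m - algebraMap D R (algebraMap R D r) • m ∈ epsSubmodule hε M := by
  obtain ⟨a, s, hs, h⟩ := hε.exists_eq r
  refine ⟨s, hs, algebraMap D R a • m, ?_⟩
  rw [← sub_smul, smul_smul]
  congr 1
  rw [mul_comm, sub_eq_iff_eq_add']
  exact h

theorem one_tmul_eq_zero_iff [IsScalarTower D R D] {m : M} :
    (1 : D) ⊗ₜ[R] m = 0 ↔ m ∈ epsSubmodule hε M := by
  constructor
  · intro h
    let φ : D →ₗ[R] M →ₗ[R] M ⧸ epsSubmodule hε M := LinearMap.mk₂ R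
      (fun d x => Submodule.Quotient.mk (algebraMap D R d • x))
      (fun d e x => by rw [map_add, add_smul, Submodule.Quotient.mk_add])
      (fun r d x => by
        rw [← Submodule.Quotient.mk_smul, eq_comm, Submodule.Quotient.eq, Algebra.smul_def,
          map_mul, mul_smul]
        exact hε.sub_smul_mem r _)
      (fun d x y => by rw [smul_add, Submodule.Quotient.mk_add])
      (fun r d x => by rw [smul_comm, Submodule.Quotient.mk_smul])
    have h0 : TensorProduct.lift φ ((1 : D) ⊗ₜ[R] m) = 0 := by rw [h, map_zero]
    simpa [φ] using h0
  · rintro ⟨s, -, x, rfl⟩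
    rw [← TensorProduct.smul_tmul, Algebra.smul_def, hε.algebraMap_eps, zero_mul,
      TensorProduct.zero_tmul]

end IsFractionQuotientExt

/-- A condition satisfied by the `R`-modules extended from torsion-free `D`-modules. -/
structure IsEpsTorsionFree {ε : D → R} (hε : IsFractionQuotientExt ε) (M : Type u)
    [AddCommGroup M] [Module R M] : Prop where
  mem_of_smul_mem : ∀ (s : D) (m : M), s ≠ 0 → algebraMap D R s • m ∈ epsSubmodule hε M →
    m ∈ epsSubmodule hε M
  exists_sub_mem : ∀ (s : D) (m : M), s ≠ 0 → ε s • m = 0 →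
    ∃ x : M, m - algebraMap D R s • x ∈ epsSubmodule hε M

namespace IsEpsTorsionFree

variable {ε : D → R} {hε : IsFractionQuotientExt ε}
  {M P : Type u} [AddCommGroup M] [Module R M] [AddCommGroup P] [Module R P]

theorem of_retract (hP : IsEpsTorsionFree hε P) (i : M →ₗ[R] P) (r : P →ₗ[R] M)
    (hri : r ∘ₗ i = LinearMap.id) : IsEpsTorsionFree hε M where
  mem_of_smul_mem s m hs hm := by
    have h := hε.map_mem r (hP.mem_of_smul_mem s (i m) hs (by
      rw [← map_smul]; exact hε.map_mem i hm))
    rwa [← LinearMap.comp_apply, hri] at h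
  exists_sub_mem s m hs hm := by
    obtain ⟨x, hx⟩ := hP.exists_sub_mem s (i m) hs (by rw [← map_smul, hm, map_zero])
    refine ⟨r x, ?_⟩
    have h := hε.map_mem r hx
    rwa [map_sub, map_smul, ← LinearMap.comp_apply, hri] at h

theorem mem_epsSubmodule_pi {n : ℕ} {m : Fin n → R} :
    m ∈ epsSubmodule hε (Fin n → R) ↔ ∀ i, m i ∈ epsSubmodule hε R := by
  refine ⟨fun h i => hε.map_mem (LinearMap.proj i) h, fun h => ?_⟩
  rw [← Finset.univ_sum_single m]
  exact Submodule.sum_mem _ fun i _ => hε.map_mem (LinearMap.single R (fun _ => R) i) (h i)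

theorem mem_epsSubmodule_self [IsScalarTower D R D] {r : R} :
    r ∈ epsSubmodule hε R ↔ algebraMap R D r = 0 := by
  constructor
  · rintro ⟨s, -, x, rfl⟩
    rw [smul_eq_mul, map_mul, hε.algebraMap_eps, zero_mul]
  · intro h
    simpa [h] using hε.sub_smul_mem r (1 : R)

theorem self [IsScalarTower D R D] : IsEpsTorsionFree hε R where
  mem_of_smul_mem s m hs hm := by
    rw [mem_epsSubmodule_self, smul_eq_mul, map_mul, ← IsScalarTower.algebraMap_apply] at hm
    exact mem_epsSubmodule_self.2 ((mul_eq_zero.1 hm).resolve_left hs)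
  exists_sub_mem s m hs hm := by
    have hm' := hε.sub_smul_mem m (1 : R)
    rw [smul_eq_mul, smul_eq_mul, mul_one, mul_one] at hm'
    have h0 := hε.eps_smul_eq_zero s hm'
    rw [smul_sub, hm, zero_sub, neg_eq_zero, smul_eq_mul, mul_comm] at h0
    obtain ⟨d, hd⟩ := hε.dvd_of_mul_eps _ _ hs h0
    refine ⟨algebraMap D R d, ?_⟩
    rwa [smul_eq_mul, ← map_mul, ← hd]

theorem pi [IsScalarTower D R D] (n : ℕ) : IsEpsTorsionFree hε (Fin n → R) where
  mem_of_smul_mem s m hs hm := by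
    rw [mem_epsSubmodule_pi] at hm ⊢
    exact fun i => self.mem_of_smul_mem s (m i) hs (hm i)
  exists_sub_mem s m hs hm := by
    choose x hx using fun i => (self (hε := hε)).exists_sub_mem s (m i) hs (congrFun hm i)
    exact ⟨x, mem_epsSubmodule_pi.2 hx⟩

theorem of_projective [IsScalarTower D R D] [Module.Finite R P] [Module.Projective R P] :
    IsEpsTorsionFree hε P := by
  obtain ⟨n, r, hr⟩ := Module.Finite.exists_fin' R P
  obtain ⟨i, hi⟩ := Module.projective_lifting_property r LinearMap.id hr
  exact (pi n).of_retract i r hi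

theorem mem_of_coe_mem {K : Submodule R P} (hK : IsEpsTorsionFree hε K) {k : K}
    (hk : (k : P) ∈ epsSubmodule hε P) : k ∈ epsSubmodule hε K := by
  obtain ⟨s, hs, h⟩ := hε.exists_smul_eq_zero hk
  refine hK.mem_of_smul_mem s k hs ?_
  rw [show algebraMap D R s • k = 0 from Subtype.ext h]
  exact zero_mem _

theorem of_surjective (hP : IsEpsTorsionFree hε P) {f : P →ₗ[R] M}
    (hf : Function.Surjective f) (hK : IsEpsTorsionFree hε (LinearMap.ker f)) :
    IsEpsTorsionFree hε M := by
  have lift_mem {m : M} (hm : m ∈ epsSubmodule hε M) : ∃ p ∈ epsSubmodule hε P, f p = m := by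
    obtain ⟨s, hs, x, rfl⟩ := hm
    obtain ⟨p, rfl⟩ := hf x
    exact ⟨_, hε.eps_smul_mem hs p, map_smul _ _ _⟩
  have torsion (s : D) (p : P) (hs : s ≠ 0) (h : f (algebraMap D R s • p) = 0) :
      f p ∈ epsSubmodule hε M := by
    let k : LinearMap.ker f := ⟨_, h⟩
    have hk : ε s • k = 0 := Subtype.ext <| by
      change ε s • algebraMap D R s • p = 0
      rw [smul_smul, mul_comm, hε.mul_eps_self hs, zero_smul]
    obtain ⟨k', hk'⟩ := hK.exists_sub_mem s k hs hk
    have hmem := hP.mem_of_smul_mem s (p - k') hs (by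
      rw [smul_sub]; exact hε.map_mem (LinearMap.ker f).subtype hk')
    simpa using hε.map_mem f hmem
  have mem_of_smul_mem (s : D) (m : M) (hs : s ≠ 0)
      (h : algebraMap D R s • m ∈ epsSubmodule hε M) : m ∈ epsSubmodule hε M := by
    obtain ⟨j, hj, hjm⟩ := lift_mem h
    obtain ⟨j', hj', rfl⟩ := hε.exists_eq_smul hj hs
    obtain ⟨p, rfl⟩ := hf m
    have hpj := torsion s (p - j') hs (by
      rw [smul_sub, map_sub, hjm, map_smul, sub_self])
    rw [map_sub] at hpj
    exact (Submodule.sub_mem_iff_left _ (hε.map_mem f hj')).1 hpj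
  refine ⟨mem_of_smul_mem, fun s m hs hm => ?_⟩
  obtain ⟨p, rfl⟩ := hf m
  let k : LinearMap.ker f := ⟨ε s • p, by rw [LinearMap.mem_ker, map_smul, hm]⟩
  obtain ⟨t, ht, k', hk'⟩ := hK.mem_of_coe_mem (k := k) (hε.eps_smul_mem hs p)
  have hk'' : ε s • p = ε t • (k' : P) := congrArg Subtype.val hk'
  have hst := mul_ne_zero hs ht
  obtain ⟨x, hx⟩ := hP.exists_sub_mem (s * t)
    (algebraMap D R t • p - algebraMap D R s • (k' : P)) hst (by
      rw [smul_sub, smul_smul, smul_smul, mul_comm _ (algebraMap D R s), hε.mul_eps s t hs ht,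
        mul_comm s t, mul_comm _ (algebraMap D R t), hε.mul_eps t s ht hs, hk'', sub_self])
  refine ⟨f x, mem_of_smul_mem t _ ht ?_⟩
  have h := hε.map_mem f hx
  rwa [map_sub, map_sub, map_smul, map_smul, LinearMap.mem_ker.1 k'.2, smul_zero, sub_zero,
    map_smul, map_mul, mul_comm, mul_smul, ← smul_sub] at h

variable [IsScalarTower D R D]

theorem of_hasFPRLen {n : ℕ} (h : HasFPRLen R n M) : IsEpsTorsionFree hε M := by
  induction n generalizing M with
  | zero =>
    obtain ⟨_, _⟩ := h
    exact of_projective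
  | succ n ih =>
    obtain ⟨P, _, _, f, _, _, hf, h⟩ := h
    exact of_projective.of_surjective hf (ih h)

theorem isTorsionFree (hM : IsEpsTorsionFree hε M) : Module.IsTorsionFree D (D ⊗[R] M) := by
  refine .of_smul_eq_zero fun s x h => ?_
  by_cases hs : s = 0
  · exact .inl hs
  obtain ⟨m, rfl⟩ := exists_one_tmul x
  rw [smul_one_tmul, hε.one_tmul_eq_zero_iff] at h
  exact .inr (hε.one_tmul_eq_zero_iff.2 (hM.mem_of_smul_mem s m hs h))

theorem injective_baseChange {f : P →ₗ[R] M} (hK : IsEpsTorsionFree hε (LinearMap.ker f)) :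
    Function.Injective ((LinearMap.ker f).subtype.baseChange D) := by
  rw [injective_iff_map_eq_zero]
  intro x hx
  obtain ⟨k, rfl⟩ := exists_one_tmul x
  rw [LinearMap.baseChange_tmul, hε.one_tmul_eq_zero_iff] at hx
  exact hε.one_tmul_eq_zero_iff.2 (hK.mem_of_coe_mem hx)

/-- Reduction modulo `J` preserves finite projective resolutions. -/
theorem hasFPRLen_tensor (hε : IsFractionQuotientExt ε) {n : ℕ} (h : HasFPRLen R n M) :
    HasFPRLen D n (D ⊗[R] M) := by
  induction n generalizing M with
  | zero =>
    obtain ⟨_, _⟩ := h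
    exact ⟨inferInstance, inferInstance⟩
  | succ n ih =>
    obtain ⟨P, _, _, f, _, _, hf, h⟩ := h
    exact ⟨D ⊗[R] P, inferInstance, inferInstance, f.baseChange D, inferInstance, inferInstance,
      LinearMap.baseChange_surjective D hf, (ih h).of_equiv
        (baseChangeKerEquiv D f hf (injective_baseChange (of_hasFPRLen (hε := hε) h)))⟩

end IsEpsTorsionFree

theorem exists_one_tmul_add_eps_tmul {ε : D → R} (hε : IsFractionQuotientExt ε) {N : Type u}
    [AddCommGroup N] [Module D N] (x : R ⊗[D] N) :
    ∃ (s : D) (y z : N), s ≠ 0 ∧ x = 1 ⊗ₜ[D] y + ε s ⊗ₜ[D] z := by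
  induction x using TensorProduct.induction_on with
  | zero => exact ⟨1, 0, 0, one_ne_zero, by simp⟩
  | tmul r n =>
    obtain ⟨a, s, hs, h⟩ := hε.exists_eq r
    refine ⟨s, algebraMap R D r • n, a • n, hs, ?_⟩
    rw [tmul_smul, tmul_smul, smul_tmul', smul_tmul', ← add_tmul, Algebra.smul_def,
      Algebra.smul_def, mul_one, ← h]
  | add x y hx hy =>
    obtain ⟨s, a, b, hs, rfl⟩ := hx
    obtain ⟨t, c, d, ht, rfl⟩ := hy
    refine ⟨s * t, a + c, t • b + s • d, mul_ne_zero hs ht, ?_⟩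
    rw [tmul_add, tmul_add, tmul_smul, tmul_smul, smul_tmul', smul_tmul', Algebra.smul_def,
      Algebra.smul_def, hε.mul_eps s t hs ht, mul_comm s t, hε.mul_eps t s ht hs]
    abel

/-- A module whose reduction modulo `J` is projective is itself projective. -/
theorem IsEpsTorsionFree.projective_of_tensor [IsScalarTower D R D] {ε : D → R}
    {hε : IsFractionQuotientExt ε} {M : Type u} [AddCommGroup M] [Module R M]
    (hM : IsEpsTorsionFree hε M) (hproj : Module.Projective D (D ⊗[R] M)) :
    Module.Projective R M := by
  let : Module D M := Module.compHom M (algebraMap D R)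
  have : IsScalarTower D R M := IsScalarTower.of_algebraMap_smul fun _ _ => rfl
  let q : M →ₗ[D] D ⊗[R] M :=
    { toFun := fun m => 1 ⊗ₜ[R] m
      map_add' := fun _ _ => tmul_add _ _ _
      map_smul' := fun d m => (smul_one_tmul d m).symm }
  obtain ⟨σ, hσ⟩ := Module.projective_lifting_property q LinearMap.id fun x => by
    obtain ⟨m, rfl⟩ := exists_one_tmul x
    exact ⟨m, rfl⟩
  have hqσ (x : D ⊗[R] M) : (1 : D) ⊗ₜ[R] σ x = x := LinearMap.congr_fun hσ x
  let φ : R ⊗[D] (D ⊗[R] M) →ₗ[R] M := TensorProduct.AlgebraTensorModule.lift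
    ((LinearMap.lsmul R (D ⊗[R] M →ₗ[D] M)).flip σ)
  have hφ (r : R) (x : D ⊗[R] M) : φ (r ⊗ₜ x) = r • σ x := rfl
  have sub_mem (m : M) : m - σ (1 ⊗ₜ m) ∈ epsSubmodule hε M := by
    rw [← hε.one_tmul_eq_zero_iff, tmul_sub, hqσ, sub_self]
  have hsurj : Function.Surjective φ := by
    intro m
    obtain ⟨s, hs, x, hx⟩ := sub_mem m
    refine ⟨1 ⊗ₜ (1 ⊗ₜ m) + ε s ⊗ₜ (1 ⊗ₜ x), ?_⟩
    have h0 := hε.eps_smul_eq_zero s (sub_mem x)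
    rw [smul_sub, sub_eq_zero] at h0
    rw [map_add, hφ, hφ, one_smul, ← h0, ← hx]
    abel
  have hinj : Function.Injective φ := by
    rw [injective_iff_map_eq_zero]
    intro x hx
    obtain ⟨s, y, z, hs, rfl⟩ := exists_one_tmul_add_eps_tmul hε x
    rw [map_add, hφ, hφ, one_smul] at hx
    have hy : y = 0 := by
      rw [← hqσ y, hε.one_tmul_eq_zero_iff, eq_neg_of_add_eq_zero_left hx]
      exact neg_mem (hε.eps_smul_mem hs _)
    rw [hy, map_zero, zero_add] at hx
    obtain ⟨w, hw⟩ := hM.exists_sub_mem s _ hs hx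
    rw [← hε.one_tmul_eq_zero_iff, tmul_sub, hqσ, ← smul_one_tmul, sub_eq_zero] at hw
    rw [hy, hw, tmul_zero, zero_add, tmul_smul, smul_tmul', Algebra.smul_def,
      hε.mul_eps_self hs, zero_tmul]
  exact Module.Projective.of_equiv (LinearEquiv.ofBijective φ ⟨hinj, hsurj⟩)

theorem hasProjResLE_of_tensor [IsScalarTower D R D] {ε : D → R}
    (hε : IsFractionQuotientExt ε) {M : Type u} [AddCommGroup M] [Module R M] {m n : ℕ}
    (hM : HasFPRLen R m M) (h : HasProjResLE D n (D ⊗[R] M)) : HasProjResLE R n M := by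
  induction n generalizing M m with
  | zero => exact (IsEpsTorsionFree.of_hasFPRLen (hε := hε) hM).projective_of_tensor h
  | succ n ih =>
    cases m with
    | zero => exact HasProjResLE.mono (m := 0) hM.2 n.succ.zero_le
    | succ m =>
      obtain ⟨P, _, _, f, _, _, hf, hK⟩ := hM
      refine ⟨P, inferInstance, inferInstance, f, inferInstance, hf, ih hK ?_⟩
      exact (h.ker inferInstance (LinearMap.baseChange_surjective D hf)).of_equiv
        (baseChangeKerEquiv D f hf (IsEpsTorsionFree.injective_baseChange
          (IsEpsTorsionFree.of_hasFPRLen (hε := hε) hK))).symm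

section Extension

variable [IsScalarTower D R D] {ε : D → R}
  {N P : Type u} [AddCommGroup N] [Module D N] [AddCommGroup P] [Module D P]

theorem injective_baseChange_of_isTorsionFree (hε : IsFractionQuotientExt ε)
    [Module.IsTorsionFree D N] [Module.Finite D P] [Module.Projective D P] (f : P →ₗ[D] N) :
    Function.Injective ((LinearMap.ker f).subtype.baseChange R) := by
  let ρ : R ⊗[D] P →ₗ[D] P := (TensorProduct.lid D P).toLinearMap ∘ₗ
    (IsScalarTower.toAlgHom D R D).toLinearMap.rTensor P
  have hρ (r : R) (p : P) : ρ (r ⊗ₜ p) = algebraMap R D r • p := rfl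
  have hρ_eps (s : D) (x : R ⊗[D] P) : ρ (ε s • x) = 0 := by
    induction x using TensorProduct.induction_on with
    | zero => simp
    | tmul r p => rw [smul_tmul', hρ, smul_eq_mul, map_mul, hε.algebraMap_eps, zero_mul, zero_smul]
    | add x y hx hy => rw [smul_add, map_add, hx, hy, add_zero]
  rw [injective_iff_map_eq_zero]
  intro x hx
  obtain ⟨s, y, z, hs, rfl⟩ := exists_one_tmul_add_eps_tmul hε x
  rw [map_add, LinearMap.baseChange_tmul, LinearMap.baseChange_tmul] at hx
  have hy : y = 0 := by
    have h := congrArg ρ hx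
    rw [map_add, hρ, hρ, hε.algebraMap_eps, zero_smul, add_zero, map_one, one_smul, map_zero] at h
    exact Subtype.ext h
  have hz : ε s • (1 : R) ⊗ₜ[D] (z : P) = 0 := by
    rwa [hy, map_zero, tmul_zero, zero_add, ← mul_one (ε s), ← smul_eq_mul, ← smul_tmul'] at hx
  obtain ⟨w, t, -, v, hw⟩ :=
    (IsEpsTorsionFree.of_projective (hε := hε) (P := R ⊗[D] P)).exists_sub_mem s _ hs hz
  have hzw : (z : P) = s • ρ w := by
    have h := congrArg ρ hw
    rwa [hρ_eps, map_sub, algebraMap_smul, map_smul, hρ, map_one, one_smul, sub_eq_zero] at h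
  have hker : f (ρ w) = 0 := by
    have h : s • f (ρ w) = 0 := by rw [← map_smul, ← hzw]; exact z.2
    exact (smul_eq_zero.1 h).resolve_left hs
  obtain rfl : z = s • ⟨ρ w, hker⟩ := Subtype.ext hzw
  rw [hy, tmul_zero, zero_add, tmul_smul, smul_tmul', Algebra.smul_def, hε.mul_eps_self hs,
    zero_tmul]

/-- Extension of scalars to `R` preserves finite projective resolutions of torsion-free
modules. -/
theorem hasFPRLen_baseChange (hε : IsFractionQuotientExt ε) [Module.IsTorsionFree D N] {n : ℕ}
    (h : HasFPRLen D n N) : HasFPRLen R n (R ⊗[D] N) := by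
  induction n generalizing N with
  | zero =>
    obtain ⟨_, _⟩ := h
    exact ⟨inferInstance, inferInstance⟩
  | succ n ih =>
    obtain ⟨P, _, _, f, _, _, hf, h⟩ := h
    exact ⟨R ⊗[D] P, inferInstance, inferInstance, f.baseChange R, inferInstance, inferInstance,
      LinearMap.baseChange_surjective R hf, (ih h).of_equiv
        (baseChangeKerEquiv R f hf (injective_baseChange_of_isTorsionFree hε f))⟩

theorem hasProjResLE_of_baseChange (hε : IsFractionQuotientExt ε) [Module.IsTorsionFree D N]
    {m n : ℕ} (hN : HasFPRLen D m N) (h : HasProjResLE R n (R ⊗[D] N)) :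
    HasProjResLE D n N := by
  induction n generalizing N m with
  | zero =>
    have : Module.Projective R (R ⊗[D] N) := h
    exact Module.Projective.of_equiv
      (TensorProduct.AlgebraTensorModule.cancelBaseChange D R D D N ≪≫ₗ TensorProduct.lid D N)
  | succ n ih =>
    cases m with
    | zero => exact HasProjResLE.mono (m := 0) hN.2 n.succ.zero_le
    | succ m =>
      obtain ⟨P, _, _, f, _, _, hf, hK⟩ := hN
      refine ⟨P, inferInstance, inferInstance, f, inferInstance, hf, ih hK ?_⟩
      exact (h.ker inferInstance (LinearMap.baseChange_surjective R hf)).of_equiv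
        (baseChangeKerEquiv R f hf (injective_baseChange_of_isTorsionFree hε f)).symm

theorem fPD_le_of_isFractionQuotientExt (hε : IsFractionQuotientExt ε) :
    fPD D ≤ fPD R + 1 := by
  cases hn : fPD R with
  | top => simp
  | coe n =>
    have hR := fPD_le_iff.1 hn.le
    refine fPD_le_iff (n := n + 1).2 fun M _ _ ⟨m, hM⟩ => ?_
    cases m with
    | zero => exact HasProjResLE.mono (m := 0) hM.2 n.succ.zero_le
    | succ m =>
      obtain ⟨P, _, _, f, _, _, hf, hK⟩ := hM
      exact ⟨P, inferInstance, inferInstance, f, inferInstance, hf,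
        hasProjResLE_of_baseChange hε hK (hR _ ⟨m, hasFPRLen_baseChange hε hK⟩)⟩

end Extension

end FractionQuotientExtension

/-- The small finitistic dimension of a domain that is not a field is positive. -/
theorem fPD_ne_zero {D : Type u} [CommRing D] [IsDomain D] (hD : ¬ IsField D) : fPD D ≠ 0 := by
  intro h
  obtain ⟨x, hx0, hx⟩ := Ring.exists_not_isUnit_of_not_isField hD
  have hinj : Function.Injective (LinearMap.mulLeft D x) := mul_right_injective₀ hx0
  have hFPR : HasFPR D (D ⧸ LinearMap.range (LinearMap.mulLeft D x)) := by
    refine ⟨1, D, inferInstance, inferInstance, Submodule.mkQ _, inferInstance, inferInstance,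
      Submodule.mkQ_surjective _, ?_⟩
    rw [Submodule.ker_mkQ]
    exact HasFPRLen.of_equiv (n := 0) ⟨inferInstance, inferInstance⟩
      (LinearEquiv.ofInjective _ hinj)
  have hproj : Module.Projective D (D ⧸ LinearMap.range (LinearMap.mulLeft D x)) :=
    fPD_le_iff (n := 0).1 h.le _ hFPR
  have hzero : x • (Submodule.Quotient.mk 1 : D ⧸ LinearMap.range (LinearMap.mulLeft D x)) = 0 := by
    rw [← Submodule.Quotient.mk_smul, Submodule.Quotient.mk_eq_zero]
    exact ⟨1, by simp⟩
  have hone := (smul_eq_zero.1 hzero).resolve_left hx0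
  rw [Submodule.Quotient.mk_eq_zero] at hone
  obtain ⟨y, hy⟩ := hone
  exact hx (IsUnit.of_mul_eq_one y hy)

theorem HasProjResLE.of_isTorsionFree {D : Type u} [CommRing D] [IsDomain D] {n m : ℕ}
    (hD : fPD D ≤ (n + 1 : ℕ)) {N : Type u} [AddCommGroup N] [Module D N]
    [Module.IsTorsionFree D N] (hN : HasFPRLen D m N) : HasProjResLE D n N := by
  have := hN.finite
  obtain ⟨F, _, _, i, _, _, hi⟩ := exists_injective_of_finite_of_isTorsionFree D N
  let e : N ≃ₗ[D] LinearMap.ker (LinearMap.range i).mkQ :=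
    LinearEquiv.ofInjective i hi ≪≫ₗ LinearEquiv.ofEq _ _ (Submodule.ker_mkQ _).symm
  have hC : HasFPR D (F ⧸ LinearMap.range i) :=
    ⟨m + 1, F, inferInstance, inferInstance, (LinearMap.range i).mkQ, inferInstance,
      inferInstance, Submodule.mkQ_surjective _, hN.of_equiv e⟩
  exact ((fPD_le_iff.1 hD _ hC).ker inferInstance (Submodule.mkQ_surjective _)).of_equiv e.symm

theorem fPD_add_one_le_of_isFractionQuotientExt {D R : Type u} [CommRing D] [IsDomain D]
    [CommRing R] [Algebra D R] [Algebra R D] [IsScalarTower D R D] {ε : D → R}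
    (hε : IsFractionQuotientExt ε) (hD : ¬ IsField D) : fPD R + 1 ≤ fPD D := by
  cases hn : fPD D with
  | top => simp
  | coe n =>
    cases n with
    | zero => exact absurd hn (fPD_ne_zero hD)
    | succ n =>
      rw [Nat.cast_succ]
      gcongr
      refine fPD_le_iff.2 fun M _ _ ⟨m, hM⟩ => hasProjResLE_of_tensor hε hM ?_
      have := (IsEpsTorsionFree.of_hasFPRLen (hε := hε) hM).isTorsionFree
      exact .of_isTorsionFree hn.le (IsEpsTorsionFree.hasFPRLen_tensor hε hM)

/-- If `V` looks like `Q/D`, with `δ s` playing the role of `1/s`, then `D(+)V` looks like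
`D(+)(Q/D)`. -/
theorem isFractionQuotientExt_inr {D V : Type u} [CommRing D] [AddCommGroup V] [Module D V]
    [Module Dᵐᵒᵖ V] [IsCentralScalar D V] {δ : D → V}
    (smul_delta : ∀ s t : D, s ≠ 0 → t ≠ 0 → s • δ (s * t) = δ t) (delta_one : δ 1 = 0)
    (exists_eq : ∀ v : V, ∃ a s : D, s ≠ 0 ∧ v = a • δ s)
    (dvd_of_smul : ∀ a s : D, s ≠ 0 → a • δ s = 0 → s ∣ a) :
    letI := (TrivSqZeroExt.fstHom D D V).toAlgebra
    IsFractionQuotientExt (R := TrivSqZeroExt D V) fun s => TrivSqZeroExt.inr (δ s) := by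
  let := (TrivSqZeroExt.fstHom D D V).toAlgebra
  have hmul (a s : D) : algebraMap D (TrivSqZeroExt D V) a * TrivSqZeroExt.inr (δ s) =
      TrivSqZeroExt.inr (a • δ s) := TrivSqZeroExt.inl_mul_inr a (δ s)
  refine ⟨fun s t hs ht => ?_, ?_, fun s t => TrivSqZeroExt.inr_mul_inr _ _ _,
    fun s => TrivSqZeroExt.fst_inr D (δ s), fun r => ?_, fun a s hs h => ?_⟩
  · rw [hmul, smul_delta s t hs ht]
  · rw [delta_one, TrivSqZeroExt.inr_zero]
  · obtain ⟨a, s, hs, h⟩ := exists_eq r.snd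
    refine ⟨a, s, hs, ?_⟩
    rw [hmul, ← h]
    exact (TrivSqZeroExt.inl_fst_add_inr_snd_eq r).symm
  · rw [hmul, ← TrivSqZeroExt.inr_zero D] at h
    exact dvd_of_smul a s hs (TrivSqZeroExt.inr_injective h)

theorem fPD_trivSqZeroExt {D V : Type u} [CommRing D] [IsDomain D] [AddCommGroup V] [Module D V]
    [Module Dᵐᵒᵖ V] [IsCentralScalar D V] (hD : ¬ IsField D) {δ : D → V}
    (smul_delta : ∀ s t : D, s ≠ 0 → t ≠ 0 → s • δ (s * t) = δ t) (delta_one : δ 1 = 0)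
    (exists_eq : ∀ v : V, ∃ a s : D, s ≠ 0 ∧ v = a • δ s)
    (dvd_of_smul : ∀ a s : D, s ≠ 0 → a • δ s = 0 → s ∣ a) :
    fPD D = fPD (TrivSqZeroExt D V) + 1 := by
  let := (TrivSqZeroExt.fstHom D D V).toAlgebra
  have : IsScalarTower D (TrivSqZeroExt D V) D := .of_algebraMap_eq fun _ => rfl
  have hε := isFractionQuotientExt_inr smul_delta delta_one exists_eq dvd_of_smul
  exact (fPD_le_of_isFractionQuotientExt hε).antisymm
    (fPD_add_one_le_of_isFractionQuotientExt hε hD)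

/-- For a non-field domain `D` with quotient field `Q`,
`fPD (D(+)(Q/D)) = fPD D - 1`, i.e. `fPD D = fPD (D(+)(Q/D)) + 1`. -/
theorem fPD_trivSqZeroExt_quotient (D : Type u) [CommRing D] [IsDomain D]
    (hD : ¬ IsField D) :
    fPD D = fPD (TrivSqZeroExt D ((FractionRing D) ⧸ LinearMap.range (Algebra.linearMap D (FractionRing D)))) + 1 := by
  have hne {s : D} (hs : s ≠ 0) : algebraMap D (FractionRing D) s ≠ 0 := by simpa using hs
  have smul_mk (a : D) (q : FractionRing D) :
      a • (Submodule.Quotient.mk q :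
        FractionRing D ⧸ LinearMap.range (Algebra.linearMap D (FractionRing D))) =
        Submodule.Quotient.mk (algebraMap D (FractionRing D) a * q) := by
    rw [← Submodule.Quotient.mk_smul, Algebra.smul_def]
  refine fPD_trivSqZeroExt hD
    (δ := fun s => Submodule.Quotient.mk (algebraMap D (FractionRing D) s)⁻¹)
    (fun s t hs ht => ?_) ?_ (fun v => ?_) (fun a s hs h => ?_)
  · rw [smul_mk, map_mul, mul_inv, mul_inv_cancel_left₀ (hne hs)]
  · exact (Submodule.Quotient.mk_eq_zero _).2 (LinearMap.mem_range.2 ⟨1, by simp⟩)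
  · obtain ⟨q, rfl⟩ := Submodule.Quotient.mk_surjective _ v
    obtain ⟨a, s, hs, rfl⟩ := IsFractionRing.div_surjective (A := D) q
    exact ⟨a, s, nonZeroDivisors.ne_zero hs, by rw [smul_mk, div_eq_mul_inv]⟩
  · rw [smul_mk, Submodule.Quotient.mk_eq_zero] at h
    obtain ⟨d, hd⟩ := h
    refine ⟨d, IsFractionRing.injective D (FractionRing D) ?_⟩
    rw [Algebra.linearMap_apply] at hd
    rw [map_mul, hd, mul_left_comm, mul_inv_cancel₀ (hne hs), mul_one]
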